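/- Let A ⊂ {1,...,N} with |A| = δN, let f(n) = 1_A(n) − δ be the balanced function, and V_f(α1,α2) = Σ_{n ≤ N} f(n) e(α2 n² + α1 n). If |V_f(α)| ≥ ηN for some α ∈ T² and η > 0, then there exists an arithmetic progression P ⊂ {1,...,N} of length |P| ≫ η² N^{1/16} such that |A ∩ P| ≥ (δ + η/4)|P|. -/

import Mathlib

open Finset Complex

noncomputable def ee (x : ℝ) : ℂ := Complex.exp (Complex.I * ((2 * Real.pi * x : ℝ) : ℂ))

lemma ee_norm (x : ℝ) : ‖ee x‖ = 1 := by
  unfold ee; rw [mul_comm]; exact Complex.norm_exp_ofReal_mul_I _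

lemma ee_add (x y : ℝ) : ee (x + y) = ee x * ee y := by
  unfold ee; rw [← Complex.exp_add]; congr 1; push_cast; ring

lemma ee_int (z : ℤ) : ee (z : ℝ) = 1 := by
  unfold ee
  rw [Complex.exp_eq_one_iff]
  exact ⟨z, by push_cast; ring⟩

lemma ee_zero : ee 0 = 1 := by simpa using ee_int 0

lemma ee_nat_mul (n : ℕ) (x : ℝ) : ee (n * x) = ee x ^ n := by
  unfold ee; rw [← Complex.exp_nat_mul]; congr 1; push_cast; ring

lemma ee_sub_one_le (x : ℝ) : ‖ee x - 1‖ ≤ 2 * Real.pi * |x| := by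
  unfold ee
  refine (Real.norm_exp_I_mul_ofReal_sub_one_le).trans ?_
  rw [Real.norm_eq_abs, abs_mul, abs_of_pos (by positivity)]

lemma ee_conj (x : ℝ) : (starRingEnd ℂ) (ee x) = ee (-x) := by
  unfold ee
  rw [← Complex.exp_conj]; congr 1
  rw [map_mul, Complex.conj_I, Complex.conj_ofReal]; push_cast; ring

lemma ee_sub_le (x y : ℝ) : ‖ee x - ee y‖ ≤ 2 * Real.pi * |x - y| := by
  have : ee x - ee y = ee y * (ee (x - y) - 1) := by
    rw [mul_sub, ← ee_add]; simp
  rw [this, norm_mul, ee_norm, one_mul]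
  exact ee_sub_one_le _

lemma ee_sub_int (x : ℝ) (z : ℤ) : ee (x - z) = ee x := by
  have := ee_add (x - z) z
  rw [ee_int, mul_one] at this
  rw [← this]; simp

lemma ee_sub_one_ge (x : ℝ) : 4 * |x - round x| ≤ ‖ee x - 1‖ := by
  rw [← ee_sub_int x (round x)]
  have h := abs_sub_round x
  set y := x - round x
  unfold ee
  rw [Complex.norm_exp_I_mul_ofReal_sub_one, Real.norm_eq_abs, abs_mul]
  have e1 : 2 * Real.pi * y / 2 = Real.pi * y := by ring
  rw [e1]
  have hpi := Real.pi_pos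
  have h2 : |Real.sin (Real.pi * y)| = Real.sin (Real.pi * |y|) := by
    rcases abs_cases y with ⟨h1, h2⟩ | ⟨h1, h2⟩
    · rw [h1, abs_of_nonneg]
      apply Real.sin_nonneg_of_nonneg_of_le_pi (by positivity)
      rw [h1] at h; nlinarith
    · rw [h1, mul_neg, Real.sin_neg, abs_of_nonpos]
      have : 0 ≤ Real.sin (-(Real.pi * y)) := by
        apply Real.sin_nonneg_of_nonneg_of_le_pi
        · nlinarith
        · rw [h1] at h; nlinarith
      rw [Real.sin_neg] at this; linarith
  rw [h2]
  have := Real.mul_le_sin (x := Real.pi * |y|) (by positivity) (by nlinarith)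
  have e2 : 2 / Real.pi * (Real.pi * |y|) = 2 * |y| := by field_simp
  rw [e2] at this
  rw [abs_of_pos (by norm_num : (0:ℝ) < 2)]; linarith

lemma geom_bound (n : ℕ) (x : ℝ) :
    ‖∑ i ∈ Finset.range n, ee (i * x)‖ * |x - round x| ≤ 1 / 2 := by
  have h := geom_sum_mul (ee x) n
  simp_rw [ee_nat_mul]
  have h1 : ‖∑ i ∈ Finset.range n, ee x ^ i‖ * ‖ee x - 1‖ ≤ 2 := by
    rw [← norm_mul, h]
    refine (norm_sub_le _ _).trans ?_
    rw [norm_pow, ee_norm]; norm_num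
  have := ee_sub_one_ge x
  have h0 := norm_nonneg (∑ i ∈ Finset.range n, ee x ^ i)
  nlinarith

lemma sum_blocks {E : Type*} [AddCommMonoid E] (g : ℕ → E) (B p : ℕ) :
    ∑ d ∈ Finset.range (B * p), g d
      = ∑ b ∈ Finset.range B, ∑ j ∈ Finset.range p, g (b * p + j) := by
  induction B with
  | zero => simp
  | succ B ih => rw [Nat.succ_mul, Finset.sum_range_add, ih, Finset.sum_range_succ]

lemma b1_sum (p : ℕ) (M : ℝ) (hM : 0 ≤ M) :
    ∑ s ∈ Finset.range p, (if s < 2 then M else (p:ℝ) / (2 * ((s:ℝ) - 1)))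
      ≤ 2 * M + p / 2 * (1 + Real.log p) := by
  have hlog : (0:ℝ) ≤ 1 + Real.log p := by
    have := Real.log_natCast_nonneg p; linarith
  rcases Nat.lt_or_ge p 2 with hp | hp
  · interval_cases p
    · simp; linarith
    · simp; linarith
  · obtain ⟨k, rfl⟩ : ∃ k, p = 2 + k := ⟨p - 2, by omega⟩
    rw [Finset.sum_range_add]
    have e1 : ∑ s ∈ Finset.range 2, (if s < 2 then M else ((2 + k : ℕ):ℝ) / (2 * ((s:ℝ) - 1))) = 2 * M := by
      simp [Finset.sum_range_succ]; ring
    have e2 : ∑ s ∈ Finset.range k, (if 2 + s < 2 then M else ((2 + k : ℕ):ℝ) / (2 * (((2 + s : ℕ):ℝ) - 1)))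
       = ((2 + k : ℕ):ℝ) / 2 * (harmonic k : ℚ) := by
      rw [harmonic]; push_cast; rw [Finset.mul_sum]
      apply Finset.sum_congr rfl
      intro s _
      rw [if_neg (by omega)]
      have : (2 + (s:ℝ) - 1) = s + 1 := by ring
      rw [this, div_mul_eq_div_div]; rfl
    rw [e1, e2]
    have h1 := harmonic_le_one_add_log k
    have h2 : Real.log k ≤ Real.log ((2 + k : ℕ) : ℝ) := by
      rcases Nat.eq_zero_or_pos k with h | h
      · subst h; simp; positivity
      · apply Real.log_le_log (by exact_mod_cast h); push_cast; linarith
    gcongr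
    linarith

set_option maxHeartbeats 2000000 in
lemma block_bound (p : ℕ) (hp : 0 < p) (a : ℤ) (hap : IsCoprime a (p:ℤ)) (γ : ℝ)
    (hγ : |p * γ - a| ≤ 1 / p) (M : ℝ) (hM : 0 ≤ M) (g : ℕ → ℝ)
    (hgM : ∀ d, g d ≤ M) (hg : ∀ d, g d * |γ * d - round (γ * d)| ≤ 1 / 2) (d0 : ℕ) :
    ∑ j ∈ Finset.range p, g (d0 + j) ≤ 4 * M + p * (1 + Real.log p) := by
  set c : ℤ := ⌊p * γ * d0⌋ with hc
  have hpR : (0:ℝ) < p := by exact_mod_cast hp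
  let s : ℕ → ℕ := fun j => ((a * j + c) % (p:ℤ)).toNat
  have hs : ∀ j, ((s j : ℕ) : ℤ) = (a * j + c) % (p:ℤ) := fun j =>
    Int.toNat_of_nonneg (Int.emod_nonneg _ (by omega))
  have hsp : ∀ j, s j < p := fun j => by
    have := Int.emod_lt_of_pos (a * j + c) (by omega : (0:ℤ) < p)
    rw [← hs] at this; exact_mod_cast this
  let b : ℕ → ℝ := fun s => (if s < 2 then M else (p:ℝ) / (2 * ((s:ℝ) - 1)))
  have hb0 : ∀ s, 0 ≤ b s := by
    intro s; simp only [b]; split_ifs with h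
    · exact hM
    · have : (2:ℝ) ≤ s := by exact_mod_cast (not_lt.mp h)
      apply div_nonneg hpR.le; linarith
  have key : ∀ j ∈ Finset.range p, g (d0 + j) ≤ b (s j) + b (p - 1 - s j) := by
    intro j hj
    have hj := Finset.mem_range.mp hj
    by_cases h1 : s j < 2
    · have : b (s j) = M := if_pos h1
      rw [this]; linarith [hgM (d0 + j), hb0 (p - 1 - s j)]
    by_cases h2 : p - 1 - s j < 2
    · have : b (p - 1 - s j) = M := if_pos h2
      rw [this]; linarith [hgM (d0 + j), hb0 (s j)]
    have hb1 : b (s j) = (p:ℝ) / (2 * ((s j:ℝ) - 1)) := if_neg h1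
    have hb2 : b (p - 1 - s j) = (p:ℝ) / (2 * ((p:ℝ) - 2 - s j)) := by
      simp only [b]
      rw [if_neg h2]
      have h3 := hsp j
      rw [Nat.cast_sub (by omega), Nat.cast_sub (by omega)]; push_cast
      congr 2; ring
    rw [hb1, hb2]
    -- analysis
    set t : ℤ := (a * j + c) / (p:ℤ) with ht
    have hdiv : (a * j + c : ℤ) = s j + p * t := by
      rw [hs, ht]; exact (Int.emod_add_mul_ediv _ _).symm
    have hdivR : (a * j + c : ℝ) = s j + p * t := by exact_mod_cast hdiv
    set x := γ * ((d0 + j : ℕ) : ℝ) with hx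
    set u := p * (x - t) - s j with hu
    have hu' : u = (p * γ * d0 - c) + (p * γ - a) * j := by
      rw [hu, hx]; push_cast; linear_combination hdivR
    have hf1 : (c:ℝ) ≤ p * γ * d0 := Int.floor_le _
    have hf2 : p * γ * d0 < c + 1 := Int.lt_floor_add_one _
    have hjp : (j:ℝ) ≤ p := by exact_mod_cast hj.le
    have hsm : |(p * γ - a) * j| ≤ 1 := by
      rw [abs_mul, abs_of_nonneg (by positivity : (0:ℝ) ≤ j)]
      calc _ ≤ 1 / (p:ℝ) * p := by gcongr
        _ = 1 := by field_simp
    have hsm' := abs_le.mp hsm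
    have hu1 : -1 ≤ u := by rw [hu']; linarith
    have hu2 : u ≤ 2 := by rw [hu']; linarith
    have hs2 : (2:ℝ) ≤ s j := by exact_mod_cast (not_lt.mp h1)
    have hs3 : (s j : ℝ) + 3 ≤ p := by
      have : s j + 3 ≤ p := by omega
      exact_mod_cast this
    have hxt : x = t + (s j + u) / p := by rw [hu]; field_simp; ring
    have hgx := hg (d0 + j)
    rw [← hx] at hgx
    set z := round x
    by_cases hg0 : g (d0 + j) ≤ 0
    · refine hg0.trans ?_
      apply add_nonneg <;> apply div_nonneg hpR.le <;> linarith
    push Not at hg0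
    have n1 : 0 ≤ (p:ℝ) / (2 * ((s j:ℝ) - 1)) := by apply div_nonneg hpR.le; linarith
    have n2 : 0 ≤ (p:ℝ) / (2 * ((p:ℝ) - 2 - s j)) := by apply div_nonneg hpR.le; linarith
    have hpx : p * (x - z) = p * ((t - z : ℤ) : ℝ) + s j + u := by
      rw [hu]; push_cast; ring
    rcases le_or_gt z t with hz | hz
    · have hz' : (0:ℝ) ≤ ((t - z : ℤ) : ℝ) := by exact_mod_cast (by omega : 0 ≤ t - z)
      have h5 : (s j:ℝ) - 1 ≤ p * |x - z| := by
        calc (s j:ℝ) - 1 ≤ p * (x - z) := by rw [hpx]; nlinarith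
          _ ≤ _ := by gcongr; exact le_abs_self _
      have : g (d0 + j) ≤ (p:ℝ) / (2 * ((s j:ℝ) - 1)) := by
        rw [le_div_iff₀ (by linarith)]
        nlinarith
      linarith
    · have hz' : ((t - z : ℤ) : ℝ) ≤ -1 := by exact_mod_cast (by omega : t - z ≤ -1)
      have h5 : (p:ℝ) - 2 - s j ≤ p * |x - z| := by
        calc (p:ℝ) - 2 - s j ≤ p * (-(x - z)) := by rw [mul_neg, hpx]; nlinarith
          _ ≤ _ := by gcongr; exact neg_le_abs _
      have : g (d0 + j) ≤ (p:ℝ) / (2 * ((p:ℝ) - 2 - s j)) := by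
        rw [le_div_iff₀ (by linarith)]
        nlinarith
      linarith
  have hinj : Set.InjOn s (Finset.range p : Set ℕ) := by
    intro j hj k hk hjk
    simp only [Finset.coe_range, Set.mem_Iio] at hj hk
    have h1 : (a * j + c) % (p:ℤ) = (a * k + c) % (p:ℤ) := by rw [← hs, ← hs, hjk]
    have h2 : (p:ℤ) ∣ a * (k - j) := by
      have := Int.ModEq.dvd (h1 : (a * j + c) ≡ (a * k + c) [ZMOD p])
      convert this using 1; ring
    have h3 : (p:ℤ) ∣ (k - j) := hap.symm.dvd_of_dvd_mul_left h2
    have h4 : ((k:ℤ) - j) = 0 := Int.eq_zero_of_abs_lt_dvd h3 (by rw [abs_lt]; omega)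
    omega
  calc ∑ j ∈ Finset.range p, g (d0 + j)
      ≤ ∑ j ∈ Finset.range p, (b (s j) + b (p - 1 - s j)) := Finset.sum_le_sum key
    _ = ∑ i ∈ (Finset.range p).image s, (b i + b (p - 1 - i)) := by
        rw [Finset.sum_image hinj]
    _ ≤ ∑ i ∈ Finset.range p, (b i + b (p - 1 - i)) := by
        apply Finset.sum_le_sum_of_subset_of_nonneg
        · intro i hi
          obtain ⟨j, _, rfl⟩ := Finset.mem_image.mp hi
          exact Finset.mem_range.mpr (hsp j)
        · intros; exact add_nonneg (hb0 _) (hb0 _)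
    _ = 2 * ∑ i ∈ Finset.range p, b i := by
        rw [Finset.sum_add_distrib, Finset.sum_range_reflect, two_mul]
    _ ≤ _ := by
        have := b1_sum p M hM
        simp only [b]; linarith

lemma vdc (x : ℕ → ℂ) (hx : ∀ i, ‖x i‖ = 1) (M : ℕ) :
    ‖∑ i ∈ Finset.range M, x i‖ ^ 2 ≤ M + 2 * ∑ d ∈ Finset.range M,
      ‖∑ i ∈ Finset.range (M - (d + 1)), x (i + (d + 1)) * (starRingEnd ℂ) (x i)‖ := by
  have h1 : ‖∑ i ∈ Finset.range M, x i‖ ^ 2 = M + 2 * (∑ j ∈ Finset.range M,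
      ∑ i ∈ Finset.range j, x j * (starRingEnd ℂ) (x i)).re := by
    induction M with
    | zero => simp
    | succ M ih =>
      rw [Finset.sum_range_succ, Finset.sum_range_succ, ← Complex.normSq_eq_norm_sq,
        Complex.normSq_add, Complex.normSq_eq_norm_sq, Complex.normSq_eq_norm_sq, ih, hx,
        ← Finset.mul_sum, Complex.add_re]
      have : (∑ i ∈ Finset.range M, x i) * (starRingEnd ℂ) (x M)
        = (starRingEnd ℂ) (x M * ∑ i ∈ Finset.range M, (starRingEnd ℂ) (x i)) := by
        simp [map_sum]; ring
      rw [this, Complex.conj_re]; push_cast; ring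
  have h2 : ∑ j ∈ Finset.range M, ∑ i ∈ Finset.range j, x j * (starRingEnd ℂ) (x i)
      = ∑ d ∈ Finset.range M, ∑ i ∈ Finset.range (M - (d + 1)),
          x (i + (d + 1)) * (starRingEnd ℂ) (x i) := by
    rw [Finset.sum_sigma', Finset.sum_sigma']
    refine Finset.sum_bij' (fun p _ => ⟨p.1 - p.2 - 1, p.2⟩) (fun p _ => ⟨p.2 + (p.1 + 1), p.2⟩)
      ?_ ?_ ?_ ?_ ?_
    · rintro ⟨j, i⟩ h; simp at h ⊢; omega
    · rintro ⟨j, i⟩ h; simp at h ⊢; omega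
    · rintro ⟨j, i⟩ h; simp at h ⊢; omega
    · rintro ⟨j, i⟩ h; simp
    · rintro ⟨j, i⟩ h; simp at h ⊢
      left; congr 1
      try omega
  rw [h1, h2]
  gcongr
  refine (Complex.re_le_norm _).trans (norm_sum_le _ _)

lemma weyl (β : ℝ) (M p : ℕ) (hp : 0 < p) (a : ℤ) (hap : IsCoprime a (p:ℤ))
    (hγ : |p * (2 * β) - a| ≤ 1 / p) :
    ‖∑ q ∈ Finset.range M, ee (β * ((q + 1 : ℕ):ℝ) ^ 2)‖ ^ 2
      ≤ M + 2 * ((M / p + 1) * (4 * M + p * (1 + Real.log p))) := by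
  have hpR : (0:ℝ) < p := by exact_mod_cast hp
  have hlog := Real.log_natCast_nonneg p
  refine (vdc _ (fun _ => ee_norm _) M).trans ?_
  let g : ℕ → ℝ := fun d => ‖∑ i ∈ Finset.range (M - d), ee (i * (2 * β * d))‖
  have hg : ∀ d, ‖∑ i ∈ Finset.range (M - d), ee (β * ((i + d + 1 : ℕ):ℝ) ^ 2) *
      (starRingEnd ℂ) (ee (β * ((i + 1 : ℕ):ℝ) ^ 2))‖ = g d := by
    intro d
    have : ∀ i : ℕ, ee (β * ((i + d + 1 : ℕ):ℝ) ^ 2) *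
      (starRingEnd ℂ) (ee (β * ((i + 1 : ℕ):ℝ) ^ 2)) = ee (β * (d ^ 2 + 2 * d)) * ee (i * (2 * β * d)) := by
      intro i
      rw [ee_conj, ← ee_add, ← ee_add]; congr 1; push_cast; ring
    simp_rw [this, ← Finset.mul_sum, norm_mul, ee_norm, one_mul, g]
  have hgM : ∀ d, g d ≤ M := by
    intro d
    refine (norm_sum_le _ _).trans ?_
    simp_rw [ee_norm]; simp
  have hg0 : ∀ d, 0 ≤ g d := fun d => norm_nonneg _
  have hgr : ∀ d : ℕ, g d * |2 * β * d - round (2 * β * d)| ≤ 1 / 2 := fun d => geom_bound _ _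
  have : ∑ d ∈ Finset.range M, ‖∑ i ∈ Finset.range (M - (d + 1)), ee (β * ((i + (d + 1) + 1 : ℕ):ℝ) ^ 2) *
      (starRingEnd ℂ) (ee (β * ((i + 1 : ℕ):ℝ) ^ 2))‖ = ∑ d ∈ Finset.range M, g (d + 1) :=
    Finset.sum_congr rfl fun d _ => hg (d + 1)
  rw [this]
  gcongr
  calc ∑ d ∈ Finset.range M, g (d + 1)
      ≤ ∑ d ∈ Finset.range ((M / p + 1) * p), g (d + 1) := by
        apply Finset.sum_le_sum_of_subset_of_nonneg
        · apply Finset.range_subset_range.mpr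
          have := Nat.div_add_mod M p
          have := Nat.mod_lt M hp
          nlinarith
        · intros; exact hg0 _
    _ = ∑ b ∈ Finset.range (M / p + 1), ∑ j ∈ Finset.range p, g (b * p + 1 + j) := by
        rw [sum_blocks]
        simp_rw [add_right_comm]
    _ ≤ ∑ b ∈ Finset.range (M / p + 1), (4 * M + p * (1 + Real.log p)) := by
        apply Finset.sum_le_sum
        intro b _
        exact block_bound p hp a hap (2 * β) hγ M (by positivity) g hgM hgr _
    _ = ((M / p : ℕ) + 1) * (4 * M + p * (1 + Real.log p)) := by simp; ring
    _ ≤ _ := by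
        gcongr
        exact Nat.cast_div_le
lemma schur (u : ℕ → ℝ) (n M : ℕ) (x : ℕ → ℝ) (s : ℝ) (hs0 : 0 ≤ s)
    (hs : ∀ h : ℕ, 1 ≤ h → h < n → ‖∑ q ∈ Finset.range M, ee (h * x q)‖ ≤ s) :
    |∑ q ∈ Finset.range M, ‖∑ j ∈ Finset.range n, (u j : ℂ) * ee (j * x q)‖ ^ 2
      - M * ∑ j ∈ Finset.range n, u j ^ 2| ≤ s * n * ∑ j ∈ Finset.range n, u j ^ 2 := by
  have e1 : ((∑ q ∈ Finset.range M, ‖∑ j ∈ Finset.range n, (u j : ℂ) * ee (j * x q)‖ ^ 2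
      - M * ∑ j ∈ Finset.range n, u j ^ 2 : ℝ) : ℂ) =
      ∑ j ∈ Finset.range n, ∑ k ∈ Finset.range n, (u j : ℂ) * u k *
        (∑ q ∈ Finset.range M, ee (((j:ℝ) - k) * x q) - if j = k then (M:ℂ) else 0) := by
    simp_rw [mul_sub, Finset.sum_sub_distrib]
    push_cast
    congr 1
    · have hq : ∀ q, ((‖∑ j ∈ Finset.range n, (u j : ℂ) * ee (j * x q)‖ : ℝ) : ℂ) ^ 2 =
          ∑ j ∈ Finset.range n, ∑ k ∈ Finset.range n, (u j : ℂ) * u k * ee (((j:ℝ) - k) * x q) := by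
        intro q
        rw [← Complex.mul_conj', map_sum, Finset.sum_mul_sum]
        apply Finset.sum_congr rfl; intro j _
        apply Finset.sum_congr rfl; intro k _
        rw [map_mul, Complex.conj_ofReal, ee_conj, sub_mul, sub_eq_add_neg, ee_add]
        ring
      simp_rw [hq]
      rw [Finset.sum_comm]
      apply Finset.sum_congr rfl; intro j _
      rw [Finset.sum_comm]
      apply Finset.sum_congr rfl; intro k _
      rw [Finset.mul_sum]
    · rw [Finset.mul_sum]
      apply Finset.sum_congr rfl; intro j hj
      simp only [mul_ite, mul_zero]
      rw [Finset.sum_ite_eq, if_pos hj]; ring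
  have e2 : ∀ j ∈ Finset.range n, ∀ k ∈ Finset.range n,
      ‖∑ q ∈ Finset.range M, ee (((j:ℝ) - k) * x q) - if j = k then (M:ℂ) else 0‖ ≤ s := by
    intro j hj k hk
    have hj := Finset.mem_range.mp hj
    have hk := Finset.mem_range.mp hk
    rcases lt_trichotomy j k with h | h | h
    · rw [if_neg h.ne, sub_zero]
      have := hs (k - j) (by omega) (by omega)
      rw [← Complex.norm_conj, map_sum]
      simp_rw [ee_conj]
      convert this using 4 with q
      rw [Nat.cast_sub h.le]; ring
    · subst h; simp [ee_zero, hs0]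
    · rw [if_neg h.ne', sub_zero]
      have := hs (j - k) (by omega) (by omega)
      rw [Nat.cast_sub h.le] at this
      exact this
  rw [← Real.norm_eq_abs, ← Complex.norm_real, e1]
  calc _ ≤ ∑ j ∈ Finset.range n, ∑ k ∈ Finset.range n, |u j| * |u k| * s := by
        refine (norm_sum_le _ _).trans (Finset.sum_le_sum fun j hj => ?_)
        refine (norm_sum_le _ _).trans (Finset.sum_le_sum fun k hk => ?_)
        rw [norm_mul, norm_mul, Complex.norm_real, Complex.norm_real, Real.norm_eq_abs,
          Real.norm_eq_abs]
        exact mul_le_mul_of_nonneg_left (e2 j hj k hk) (by positivity)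
    _ = s * (∑ j ∈ Finset.range n, |u j|) ^ 2 := by
        rw [sq, Finset.sum_mul_sum, Finset.mul_sum]
        apply Finset.sum_congr rfl; intro j _
        rw [Finset.mul_sum]
        apply Finset.sum_congr rfl; intro k _
        ring
    _ ≤ s * (n * ∑ j ∈ Finset.range n, u j ^ 2) := by
        gcongr
        have := sq_sum_le_card_mul_sum_sq (s := Finset.range n) (f := fun j => |u j|)
        simpa using this
    _ = _ := by ring

lemma heil_crit (m M : ℕ) (hm : 1 ≤ m) (hM : 1 ≤ M) (x : ℕ → ℝ)
    (hs : ∀ h : ℕ, 1 ≤ h → h < 2 * m →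
      ‖∑ q ∈ Finset.range M, ee (h * x q)‖ ≤ (M:ℝ) / (8 * m)) :
    ∃ q < M, |x q - round (x q)| ≤ 2 / m := by
  by_contra! hcon
  have hmR : (1:ℝ) ≤ m := by exact_mod_cast hm
  have hMR : (1:ℝ) ≤ M := by exact_mod_cast hM
  let w : ℕ → ℝ := fun j => ((min j (2 * m - j) : ℕ) : ℝ)
  let v : ℕ → ℝ := fun j => w (j + 1) - w j
  have hw0 : w 0 = 0 := by simp [w]
  have hwm : w (2 * m) = 0 := by simp [w]
  have hv : ∀ j ∈ Finset.range (2 * m), v j ^ 2 = 1 := by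
    intro j hj
    have hj := Finset.mem_range.mp hj
    rcases Nat.lt_or_ge j m with h | h
    · have h1 : w (j + 1) = j + 1 := by
        simp only [w]; rw [min_eq_left (by omega)]; push_cast; ring
      have h2 : w j = j := by simp only [w]; rw [min_eq_left (by omega)]
      simp only [v]; rw [h1, h2]; ring
    · have h1 : w (j + 1) = 2 * m - j - 1 := by
        simp only [w]; rw [min_eq_right (by omega), Nat.cast_sub (by omega)]; push_cast; ring
      have h2 : w j = 2 * m - j := by
        simp only [w]; rw [min_eq_right (by omega), Nat.cast_sub (by omega)]; push_cast; ring
      simp only [v]; rw [h1, h2]; ring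
  have hvs : ∑ j ∈ Finset.range (2 * m), v j ^ 2 = 2 * m := by
    rw [Finset.sum_congr rfl hv]; simp
  have hws : (m:ℝ) ^ 3 / 2 ≤ ∑ j ∈ Finset.range (2 * m), w j ^ 2 := by
    rw [two_mul m, Finset.sum_range_add, ← Finset.sum_add_distrib]
    calc (m:ℝ) ^ 3 / 2 = ∑ j ∈ Finset.range m, (m:ℝ) ^ 2 / 2 := by simp; ring
      _ ≤ _ := by
        apply Finset.sum_le_sum
        intro j hj
        have hj := Finset.mem_range.mp hj
        have h1 : w j = j := by simp only [w]; rw [min_eq_left (by omega)]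
        have h2 : w (m + j) = m - j := by
          simp only [w]; rw [min_eq_right (by omega), Nat.cast_sub (by omega)]; push_cast; ring
        rw [h1, h2]; nlinarith [sq_nonneg ((m:ℝ) - 2 * j)]
  have hVW : ∀ y : ℝ, ee y * ∑ j ∈ Finset.range (2 * m), (v j : ℂ) * ee (j * y)
      = (1 - ee y) * ∑ j ∈ Finset.range (2 * m), (w j : ℂ) * ee (j * y) := by
    intro y
    have h1 := Finset.sum_range_succ (fun j => (w j : ℂ) * ee (j * y)) (2 * m)
    have h2 := Finset.sum_range_succ' (fun j => (w j : ℂ) * ee (j * y)) (2 * m)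
    rw [h1] at h2
    simp only [hw0, hwm, Complex.ofReal_zero, zero_mul, add_zero] at h2
    have h3 : ∑ j ∈ Finset.range (2 * m), (w (j + 1) : ℂ) * ee (((j + 1 : ℕ) : ℝ) * y)
      = ee y * ∑ j ∈ Finset.range (2 * m), (w (j + 1) : ℂ) * ee (j * y) := by
      rw [Finset.mul_sum]
      apply Finset.sum_congr rfl; intro j _
      have : (((j + 1 : ℕ) : ℝ) * y) = y + j * y := by push_cast; ring
      rw [this, ee_add]; ring
    simp only [v, Complex.ofReal_sub, sub_mul, Finset.sum_sub_distrib, mul_sub]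
    rw [← h3, ← h2]; ring
  have hpt : ∀ q ∈ Finset.range M, 64 / (m:ℝ) ^ 2 *
      ‖∑ j ∈ Finset.range (2 * m), (w j : ℂ) * ee (j * x q)‖ ^ 2 ≤
      ‖∑ j ∈ Finset.range (2 * m), (v j : ℂ) * ee (j * x q)‖ ^ 2 := by
    intro q hq
    have h1 := congrArg norm (hVW (x q))
    rw [norm_mul, norm_mul, ee_norm, one_mul, norm_sub_rev] at h1
    rw [h1, mul_pow]
    have h2 := ee_sub_one_ge (x q)
    have h3 := hcon q (Finset.mem_range.mp hq)
    have h4 : 8 / (m:ℝ) ≤ ‖ee (x q) - 1‖ := by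
      have : 8 / (m:ℝ) = 4 * (2 / m) := by ring
      linarith
    gcongr
    calc 64 / (m:ℝ) ^ 2 = (8 / m) ^ 2 := by ring
      _ ≤ _ := by gcongr
  have hsum := Finset.sum_le_sum hpt
  rw [← Finset.mul_sum] at hsum
  have hV := schur v (2 * m) M x _ (by positivity) hs
  have hW := schur w (2 * m) M x _ (by positivity) hs
  have e : (M:ℝ) / (8 * m) * ((2 * m : ℕ) : ℝ) = M / 4 := by push_cast; field_simp; norm_num
  rw [e] at hV hW
  rw [hvs] at hV
  have hV' := (abs_le.mp hV).2
  have hW' := (abs_le.mp hW).1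
  have h5 : (3:ℝ) / 4 * M * (m ^ 3 / 2) ≤ ∑ q ∈ Finset.range M,
      ‖∑ j ∈ Finset.range (2 * m), (w j : ℂ) * ee (j * x q)‖ ^ 2 := by nlinarith
  have h6 : 64 / (m:ℝ) ^ 2 * ((3:ℝ) / 4 * M * (m ^ 3 / 2)) ≤ 5 / 2 * M * m := by
    calc _ ≤ _ := mul_le_mul_of_nonneg_left h5 (by positivity)
      _ ≤ _ := hsum
      _ ≤ _ := by linarith
  have h7 : 64 / (m:ℝ) ^ 2 * ((3:ℝ) / 4 * M * (m ^ 3 / 2)) = 24 * (M * m) := by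
    field_simp; norm_num
  rw [h7] at h6
  nlinarith

lemma heilbronn (α : ℝ) (m M : ℕ) (hm : 1 ≤ m) (hM : 2 ^ 26 * m ^ 7 ≤ M ^ 2) :
    ∃ q : ℕ, 1 ≤ q ∧ q ≤ M ∧ ∃ z : ℤ, |α * (q:ℝ) ^ 2 - z| ≤ 2 / m := by
  have hmR : (1:ℝ) ≤ m := by exact_mod_cast hm
  have hMm : 2 ^ 13 * m ^ 3 ≤ M := by
    have : (2 ^ 13 * m ^ 3) ^ 2 ≤ M ^ 2 := by
      refine le_trans ?_ hM
      have : m ^ 6 ≤ m ^ 7 := Nat.pow_le_pow_right hm (by norm_num)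
      calc _ = 2 ^ 26 * m ^ 6 := by ring
        _ ≤ _ := by omega
    exact (Nat.pow_le_pow_iff_left (by norm_num)).mp this
  have hM1 : 1 ≤ M := by
    have : 1 ≤ m ^ 3 := Nat.one_le_pow _ _ hm
    omega
  have hMR : (2:ℝ) ^ 26 * m ^ 7 ≤ M ^ 2 := by exact_mod_cast hM
  have hMmR : (2:ℝ) ^ 13 * m ^ 3 ≤ M := by exact_mod_cast hMm
  have hM0 : (1:ℝ) ≤ M := by exact_mod_cast hM1
  by_cases hcase : ∃ h p : ℕ, ∃ a : ℤ, 1 ≤ h ∧ h < 2 * m ∧ 1 ≤ p ∧ p ≤ 2048 * m ^ 2 ∧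
      |p * (2 * h * α) - a| ≤ 1 / (4096 * (m:ℝ) ^ 4)
  · obtain ⟨h, p, a, hh1, hh2, hp1, hp2, hap⟩ := hcase
    have hq : 2 * h * p ≤ 8192 * m ^ 3 := by
      calc 2 * h * p ≤ 2 * (2 * m) * (2048 * m ^ 2) := by gcongr
        _ = 8192 * m ^ 3 := by ring
    refine ⟨2 * h * p, ?_, by omega, 2 * h * p * a, ?_⟩
    · have := Nat.mul_pos hh1 hp1; nlinarith
    · have e : α * ((2 * h * p : ℕ) : ℝ) ^ 2 - ((2 * h * p * a : ℤ) : ℝ)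
          = ((2 * h * p : ℕ) : ℝ) * (p * (2 * h * α) - a) := by push_cast; ring
      rw [e, abs_mul, abs_of_nonneg (by positivity)]
      have hqR : ((2 * h * p : ℕ) : ℝ) ≤ 8192 * m ^ 3 := by exact_mod_cast hq
      calc _ ≤ 8192 * (m:ℝ) ^ 3 * (1 / (4096 * (m:ℝ) ^ 4)) := by gcongr
        _ = 2 / m := by field_simp; norm_num
  push Not at hcase
  have hS : ∀ h : ℕ, 1 ≤ h → h < 2 * m →
      ‖∑ q ∈ Finset.range M, ee (h * (α * ((q + 1 : ℕ) : ℝ) ^ 2))‖ ≤ (M:ℝ) / (8 * m) := by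
    intro h hh1 hh2
    obtain ⟨r, hr1, hr2⟩ := Real.exists_rat_abs_sub_le_and_den_le (2 * h * α)
      (n := 4096 * m ^ 4) (by positivity)
    set p := r.den with hp
    have hp0 : 0 < p := r.den_pos
    have hpR : (1:ℝ) ≤ p := by exact_mod_cast hp0
    have hr : (r:ℝ) = r.num / p := by rw [hp]; exact_mod_cast (Rat.num_div_den r).symm
    have hpr : |p * (2 * h * α) - r.num| ≤ 1 / (((4096 * m ^ 4 : ℕ):ℝ) + 1) := by
      have : p * (2 * h * α) - r.num = p * (2 * h * α - r) := by rw [hr]; field_simp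
      rw [this, abs_mul, abs_of_nonneg (by positivity)]
      calc _ ≤ (p:ℝ) * (1 / ((((4096 * m ^ 4 : ℕ):ℝ) + 1) * p)) := by gcongr
        _ = _ := by field_simp
    have hpT : (p:ℝ) ≤ 4096 * m ^ 4 := by exact_mod_cast hr2
    have hpP : 2048 * m ^ 2 < p := by
      by_contra! hlt
      have := hcase h p r.num hh1 hh2 hp0 hlt
      have h2 : 1 / (((4096 * m ^ 4 : ℕ):ℝ) + 1) ≤ 1 / (4096 * (m:ℝ) ^ 4) := by
        push_cast; gcongr; linarith
      linarith
    have hpPR : 2048 * (m:ℝ) ^ 2 < p := by exact_mod_cast hpP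
    have hcop : IsCoprime r.num (p:ℤ) := by
      rw [Int.isCoprime_iff_gcd_eq_one]
      exact r.reduced
    have hW := weyl (h * α) M p hp0 r.num hcop (by
      have e : (p:ℝ) * (2 * (h * α)) = p * (2 * h * α) := by ring
      rw [e]
      refine hpr.trans ?_
      apply one_div_le_one_div_of_le (by linarith)
      push_cast; linarith)
    have hlog : 1 + Real.log p ≤ 14 * m := by
      have h1 : Real.log p ≤ Real.log (4096 * m ^ 4) := Real.log_le_log (by linarith) hpT
      have h2 : Real.log (4096 * (m:ℝ) ^ 4) = 12 * Real.log 2 + 4 * Real.log m := by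
        rw [Real.log_mul (by norm_num) (by positivity), Real.log_pow]
        have : (4096:ℝ) = 2 ^ 12 := by norm_num
        rw [this, Real.log_pow]; norm_num
      have h3 := Real.log_two_lt_d9
      have h4 := Real.log_le_sub_one_of_pos (by linarith : (0:ℝ) < m)
      linarith
    simp_rw [mul_assoc] at hW
    apply le_of_sq_le_sq _ (by positivity)
    refine hW.trans ?_
    have hlog0 := Real.log_natCast_nonneg p
    have hMp : (M:ℝ) / p ≤ M / (2048 * m ^ 2) := by gcongr
    have hMp' : (M:ℝ) / p * p = M := by field_simp
    have hb : M + 2 * (((M:ℝ) / p + 1) * (4 * M + p * (1 + Real.log p)))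
        ≤ 9 * M + 8 * M * (M / (2048 * m ^ 2)) + 2 * M * (14 * m) + 2 * (4096 * m ^ 4) * (14 * m) := by
      have e : M + 2 * (((M:ℝ) / p + 1) * (4 * M + p * (1 + Real.log p)))
        = 9 * M + 8 * M * (M / p) + 2 * ((M / p) * p) * (1 + Real.log p) + 2 * p * (1 + Real.log p) := by ring
      rw [e, hMp']
      gcongr
    refine hb.trans ?_
    have key : 9 * M + 2 * M * (14 * m) + 2 * (4096 * (m:ℝ) ^ 4) * (14 * m) ≤ 3 * M ^ 2 / (256 * m ^ 2) := by
      rw [le_div_iff₀ (by positivity)]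
      have q1 : (m:ℝ) ^ 2 ≤ m ^ 3 := pow_le_pow_right₀ hmR (by norm_num)
      have q2 : (9:ℝ) * M * (256 * m ^ 2) ≤ M ^ 2 := by nlinarith
      have q3 : 2 * M * (14 * (m:ℝ)) * (256 * m ^ 2) ≤ M ^ 2 := by nlinarith
      have q4 : 2 * (4096 * (m:ℝ) ^ 4) * (14 * m) * (256 * m ^ 2) ≤ M ^ 2 := by
        have : 2 * (4096 * (m:ℝ) ^ 4) * (14 * m) * (256 * m ^ 2) = 29360128 * m ^ 7 := by ring
        rw [this]
        have : (0:ℝ) ≤ m ^ 7 := by positivity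
        linarith
      linarith
    have e8 : 8 * M * (M / (2048 * (m:ℝ) ^ 2)) = M ^ 2 / (256 * m ^ 2) := by
      field_simp; norm_num
    have e9 : ((M:ℝ) / (8 * m)) ^ 2 = M ^ 2 / (256 * m ^ 2) + 3 * M ^ 2 / (256 * m ^ 2) := by
      field_simp; norm_num
    rw [e9]; linarith
  obtain ⟨q, hq, hq2⟩ := heil_crit m M hm hM1 (fun q => α * ((q + 1 : ℕ) : ℝ) ^ 2) hS
  exact ⟨q + 1, by omega, by omega, _, hq2⟩
lemma pigeon (u : ℕ → ℂ) (v : ℕ → ℝ) (hu : ∀ i, ‖u i‖ ≤ 1) (hv : ∀ i, |v i| ≤ 1) (n q K : ℕ)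
    (hq : 0 < q) (hK : 0 < K) (θ τ : ℝ) (hτ : 2 * (q * K : ℝ) ≤ τ * n) (hθ : τ ≤ θ)
    (h : θ * n ≤ ‖∑ i ∈ Finset.range n, u i‖ + ∑ i ∈ Finset.range n, v i) :
    ∃ a, a + q * (K - 1) < n ∧
      (θ - τ) * K ≤ ‖∑ k ∈ Finset.range K, u (a + q * k)‖ + ∑ k ∈ Finset.range K, v (a + q * k) := by
  by_contra! hcon
  have hKq : 0 < K * q := Nat.mul_pos hK hq
  set B := n / (K * q) with hB
  set ρ := n % (K * q) with hρ
  have hn : n = B * (K * q) + ρ := (Nat.div_add_mod' n (K * q)).symm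
  have hρlt : ρ < K * q := Nat.mod_lt _ hKq
  have hre : ∀ {E : Type} [AddCommMonoid E] (g : ℕ → E), ∑ i ∈ Finset.range n, g i =
      ∑ b ∈ Finset.range B, ∑ s ∈ Finset.range q, ∑ k ∈ Finset.range K, g (b * (K * q) + s + q * k)
        + ∑ i ∈ Finset.range ρ, g (B * (K * q) + i) := by
    intro E _ g
    conv_lhs => rw [hn, Finset.sum_range_add, sum_blocks]
    congr 1
    apply Finset.sum_congr rfl; intro b _
    rw [sum_blocks (fun j => g (b * (K * q) + j)) K q, Finset.sum_comm]
    apply Finset.sum_congr rfl; intro s _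
    apply Finset.sum_congr rfl; intro k _
    congr 1; ring
  have hbs : ∀ b ∈ Finset.range B, ∀ s ∈ Finset.range q,
      ‖∑ k ∈ Finset.range K, u (b * (K * q) + s + q * k)‖
        + ∑ k ∈ Finset.range K, v (b * (K * q) + s + q * k) ≤ (θ - τ) * K := by
    intro b hb s hs
    have hb := Finset.mem_range.mp hb
    have hs := Finset.mem_range.mp hs
    apply (hcon _ _).le
    have h1 : (b + 1) * (K * q) ≤ B * (K * q) := Nat.mul_le_mul_right _ hb
    obtain ⟨K', rfl⟩ : ∃ K', K = K' + 1 := ⟨K - 1, by omega⟩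
    simp only [Nat.add_sub_cancel]
    nlinarith
  have hU : ‖∑ i ∈ Finset.range n, u i‖ ≤ ∑ b ∈ Finset.range B, ∑ s ∈ Finset.range q,
      ‖∑ k ∈ Finset.range K, u (b * (K * q) + s + q * k)‖ + ρ := by
    rw [hre u]
    refine (norm_add_le _ _).trans (add_le_add ?_ ?_)
    · refine (norm_sum_le _ _).trans (Finset.sum_le_sum fun b _ => norm_sum_le _ _)
    · refine (norm_sum_le _ _).trans ((Finset.sum_le_sum fun i _ => hu _).trans ?_)
      simp
  have hV : ∑ i ∈ Finset.range n, v i ≤ ∑ b ∈ Finset.range B, ∑ s ∈ Finset.range q,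
      ∑ k ∈ Finset.range K, v (b * (K * q) + s + q * k) + ρ := by
    rw [hre v]
    gcongr
    refine (Finset.sum_le_sum fun i _ => (le_abs_self _).trans (hv _)).trans ?_
    simp
  have hT : ∑ b ∈ Finset.range B, ∑ s ∈ Finset.range q,
      ‖∑ k ∈ Finset.range K, u (b * (K * q) + s + q * k)‖ + ∑ b ∈ Finset.range B, ∑ s ∈ Finset.range q,
      ∑ k ∈ Finset.range K, v (b * (K * q) + s + q * k) ≤ B * (q * ((θ - τ) * K)) := by
    simp_rw [← Finset.sum_add_distrib]
    calc _ ≤ ∑ b ∈ Finset.range B, ∑ s ∈ Finset.range q, (θ - τ) * K :=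
          Finset.sum_le_sum fun b hb => Finset.sum_le_sum fun s hs => hbs b hb s hs
      _ = _ := by simp
  have hρR : (ρ:ℝ) < K * q := by exact_mod_cast hρlt
  have hnR : (n:ℝ) = B * (K * q) + ρ := by exact_mod_cast hn
  have h0 : (0:ℝ) ≤ ρ := by positivity
  have h1 : (B:ℝ) * (q * ((θ - τ) * K)) ≤ (θ - τ) * n := by
    rw [hnR]; nlinarith
  nlinarith

lemma core (f : ℕ → ℝ) (hf : ∀ i, |f i| ≤ 1) (N : ℕ) (hf0 : ∑ i ∈ Finset.range N, f i = 0)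
    (α b c η : ℝ) (hη : 0 < η)
    (h : η * N ≤ ‖∑ i ∈ Finset.range N, (f i : ℂ) * ee (α * (i:ℝ) ^ 2 + b * i + c)‖)
    (q R K L : ℕ) (hq : 0 < q) (hR : 0 < R) (hK : 0 < K) (hL : 0 < L) (ε : ℝ) (z : ℤ)
    (hz : |α * (q:ℝ) ^ 2 - z| ≤ ε)
    (h1 : 2 * (q * K : ℝ) ≤ η / 8 * N) (h2 : 2 * (R * L : ℝ) ≤ η / 8 * K)
    (h3 : 2 * Real.pi * (ε * K ^ 2 + L / R) ≤ η / 8) :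
    ∃ a d : ℕ, 0 < d ∧ a + d * (L - 1) < N ∧ η / 4 * L ≤ ∑ k ∈ Finset.range L, f (a + d * k) := by
  let φ : ℕ → ℝ := fun i => α * (i:ℝ) ^ 2 + b * i + c
  let u : ℕ → ℂ := fun i => (f i : ℂ) * ee (φ i)
  have hu : ∀ i, ‖u i‖ ≤ 1 := by
    intro i
    simp only [u]; rw [norm_mul, ee_norm, mul_one, Complex.norm_real]; exact hf i
  obtain ⟨n0, hn0, hp1⟩ := pigeon u f hu hf N q K hq hK η (η / 8) h1 (by linarith)
    (by rw [hf0, add_zero]; exact h)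
  set β := 2 * α * n0 * q + b * q with hβ
  obtain ⟨r, hr0, hrR, hr⟩ := Real.exists_nat_abs_mul_sub_round_le β hR
  have hrR' : (r:ℝ) ≤ R := by exact_mod_cast hrR
  have hRR : (0:ℝ) < R := by exact_mod_cast hR
  obtain ⟨k0, hk0, hp2⟩ := pigeon (fun k => u (n0 + q * k)) (fun k => f (n0 + q * k))
    (fun _ => hu _) (fun _ => hf _) K r L hr0 hL (η - η / 8) (η / 8)
    (le_trans (by gcongr) h2) (by linarith) hp1
  refine ⟨n0 + q * k0, q * r, Nat.mul_pos hq hr0, ?_, ?_⟩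
  · calc n0 + q * k0 + q * r * (L - 1) = n0 + q * (k0 + r * (L - 1)) := by ring
      _ ≤ n0 + q * (K - 1) := by gcongr; omega
      _ < N := hn0
  have e : ∀ l, n0 + q * k0 + q * r * l = n0 + q * (k0 + r * l) := fun l => by ring
  simp_rw [e]
  set s := ∑ k ∈ Finset.range L, f (n0 + q * (k0 + r * k)) with hs
  set W := ee (φ n0 + β * k0) with hW
  have hph : ∀ l ∈ Finset.range L, ‖ee (φ (n0 + q * (k0 + r * l))) - W‖ ≤ η / 8 := by
    intro l hl
    have hl := Finset.mem_range.mp hl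
    have hlk : k0 + r * l ≤ K := by
      have : r * l ≤ r * (L - 1) := by gcongr; omega
      omega
    have hlkR : ((k0 + r * l : ℕ) : ℝ) ≤ K := by exact_mod_cast hlk
    have hlL : (l:ℝ) ≤ L := by exact_mod_cast hl.le
    rw [← ee_sub_int _ (z * ((k0 + r * l : ℕ) : ℤ) ^ 2 + round (r * β) * l)]
    refine (ee_sub_le _ _).trans (le_trans ?_ h3)
    gcongr
    have e1 : φ (n0 + q * (k0 + r * l)) - ((z * ((k0 + r * l : ℕ) : ℤ) ^ 2 + round (r * β) * l : ℤ) : ℝ)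
        - (φ n0 + β * k0) = (α * (q:ℝ) ^ 2 - z) * ((k0 + r * l : ℕ) : ℝ) ^ 2
          + (r * β - round (r * β)) * l := by
      simp only [φ, hβ]; push_cast; ring
    rw [e1]
    refine (abs_add_le _ _).trans ?_
    rw [abs_mul, abs_mul, abs_of_nonneg (by positivity : (0:ℝ) ≤ ((k0 + r * l : ℕ) : ℝ) ^ 2),
      abs_of_nonneg (by positivity : (0:ℝ) ≤ (l:ℝ))]
    have hε : 0 ≤ ε := (abs_nonneg _).trans hz
    have hr' : |r * β - round (r * β)| ≤ 1 / R := by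
      refine hr.trans ?_
      apply one_div_le_one_div_of_le hRR; linarith
    calc _ ≤ ε * (K:ℝ) ^ 2 + 1 / R * L := by gcongr
      _ = _ := by ring
  have hsum : ‖∑ k ∈ Finset.range L, u (n0 + q * (k0 + r * k))‖ ≤ |s| + η / 8 * L := by
    have e2 : ∑ k ∈ Finset.range L, u (n0 + q * (k0 + r * k)) = (s:ℂ) * W +
        ∑ k ∈ Finset.range L, (f (n0 + q * (k0 + r * k)) : ℂ) *
          (ee (φ (n0 + q * (k0 + r * k))) - W) := by
      rw [hs]; push_cast; rw [Finset.sum_mul, ← Finset.sum_add_distrib]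
      apply Finset.sum_congr rfl; intro k _
      simp only [u]; ring
    rw [e2]
    refine (norm_add_le _ _).trans (add_le_add ?_ ?_)
    · rw [norm_mul, hW, ee_norm, mul_one, Complex.norm_real, Real.norm_eq_abs]
    · refine (norm_sum_le _ _).trans ?_
      calc _ ≤ ∑ k ∈ Finset.range L, η / 8 := by
            apply Finset.sum_le_sum
            intro k hk
            rw [norm_mul, Complex.norm_real]
            calc _ ≤ 1 * (η / 8) := mul_le_mul (hf _) (hph k hk) (norm_nonneg _) (by norm_num)
              _ = _ := by ring
        _ = _ := by simp; ring
  have hL' : (0:ℝ) < L := by exact_mod_cast hL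
  have hpos : 0 < η * L := by positivity
  rcases abs_cases s with ⟨h5, h6⟩ | ⟨h5, h6⟩ <;> rw [h5] at hsum <;> linarith

set_option maxHeartbeats 2000000 in
lemma params (f : ℕ → ℝ) (hf : ∀ i, |f i| ≤ 1) (N : ℕ) (hN : 0 < N)
    (hf0 : ∑ i ∈ Finset.range N, f i = 0) (α b c η : ℝ) (hη : 0 < η)
    (h : η * N ≤ ‖∑ i ∈ Finset.range N, (f i : ℂ) * ee (α * (i:ℝ) ^ 2 + b * i + c)‖) :
    ∃ a d L : ℕ, 0 < d ∧ 0 < L ∧ a + d * (L - 1) < N ∧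
      (1 / 1000) * η ^ 2 * (N:ℝ) ^ ((1:ℝ) / 16) ≤ L ∧
      η / 4 * L ≤ ∑ k ∈ Finset.range L, f (a + d * k) := by
  have hNR : (0:ℝ) < N := by exact_mod_cast hN
  have habs : ‖∑ i ∈ Finset.range N, (f i : ℂ) * ee (α * (i:ℝ) ^ 2 + b * i + c)‖
      ≤ ∑ i ∈ Finset.range N, |f i| := by
    refine (norm_sum_le _ _).trans (Finset.sum_le_sum fun i _ => ?_)
    rw [norm_mul, ee_norm, mul_one, Complex.norm_real, Real.norm_eq_abs]
  have hη1 : η ≤ 1 := by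
    have : ∑ i ∈ Finset.range N, |f i| ≤ N := by
      refine (Finset.sum_le_sum fun i _ => hf i).trans ?_
      simp
    have : η * N ≤ 1 * N := by linarith
    exact le_of_mul_le_mul_right this hNR
  set X := (N:ℝ) ^ ((1:ℝ) / 16) with hX
  have hX0 : 0 < X := Real.rpow_pos_of_pos hNR _
  have hXN : X ^ 16 = N := by
    rw [hX, ← Real.rpow_natCast, ← Real.rpow_mul hNR.le]; norm_num
  rcases le_or_gt (1 / 1000 * η ^ 2 * X) 1 with hsmall | hbig
  · -- singletons
    have : ∃ i ∈ Finset.range N, η ≤ |f i| + f i := by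
      apply Finset.exists_le_of_sum_le (Finset.nonempty_range_iff.mpr hN.ne')
      rw [Finset.sum_add_distrib, hf0, add_zero]
      simp only [Finset.sum_const, Finset.card_range, nsmul_eq_mul]
      linarith
    obtain ⟨i, hi, hi2⟩ := this
    refine ⟨i, 1, 1, one_pos, one_pos, by simpa using hi, by simpa using hsmall, ?_⟩
    simp
    rcases abs_cases (f i) with ⟨h5, h6⟩ | ⟨h5, h6⟩ <;> linarith
  set l := 1 / 1000 * η ^ 2 * X with hl
  set L := ⌈l⌉₊ with hLdef
  have hL1 : l ≤ L := Nat.le_ceil _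
  have hL2 : (L:ℝ) ≤ 2 * l := by
    have := Nat.ceil_lt_add_one (by linarith : 0 ≤ l); linarith
  have hLone : (1:ℝ) ≤ L := by linarith
  have hL0 : 0 < L := by exact_mod_cast (by linarith : (0:ℝ) < L)
  have hLη : 1 ≤ L / η := by rw [le_div_iff₀ hη]; linarith
  set R := ⌈101 * (L / η)⌉₊ with hRdef
  have hR1 : 101 * (L / η) ≤ R := Nat.le_ceil _
  have hR2 : (R:ℝ) ≤ 102 * (L / η) := by
    have := Nat.ceil_lt_add_one (by linarith : 0 ≤ 101 * (L / η)); linarith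
  have hRone : (1:ℝ) ≤ R := by linarith
  have hR0 : 0 < R := by exact_mod_cast (by linarith : (0:ℝ) < R)
  have hRL : 1 ≤ R * L / η := by rw [le_div_iff₀ hη]; nlinarith
  set K := ⌈16 * (R * L / η)⌉₊ with hKdef
  have hK1 : 16 * (R * L / η) ≤ K := Nat.le_ceil _
  have hK2 : (K:ℝ) ≤ 17 * (R * L / η) := by
    have := Nat.ceil_lt_add_one (by linarith : 0 ≤ 16 * (R * L / η)); linarith
  have hKone : (1:ℝ) ≤ K := by linarith
  have hK0 : 0 < K := by exact_mod_cast (by linarith : (0:ℝ) < K)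
  have hK3 : (K:ℝ) ≤ 6936 / 10 ^ 6 * (η ^ 2 * X ^ 2) := by
    calc (K:ℝ) ≤ 17 * (R * L / η) := hK2
      _ ≤ 17 * (102 * (L / η) * L / η) := by gcongr
      _ = 1734 * L ^ 2 / η ^ 2 := by ring
      _ ≤ 1734 * (2 * l) ^ 2 / η ^ 2 := by gcongr
      _ = _ := by rw [hl]; field_simp; norm_num
  have hK2η : 1 ≤ (K:ℝ) ^ 2 / η := by
    rw [le_div_iff₀ hη]; nlinarith
  set m := ⌈202 * ((K:ℝ) ^ 2 / η)⌉₊ with hmdef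
  have hm1 : 202 * ((K:ℝ) ^ 2 / η) ≤ m := Nat.le_ceil _
  have hm2 : (m:ℝ) ≤ 203 * ((K:ℝ) ^ 2 / η) := by
    have := Nat.ceil_lt_add_one (by linarith : 0 ≤ 202 * ((K:ℝ) ^ 2 / η)); linarith
  have hmone : (1:ℝ) ≤ m := by linarith
  have hm3 : (m:ℝ) ≤ 1 / 100 * (η ^ 3 * X ^ 4) := by
    calc (m:ℝ) ≤ 203 * ((K:ℝ) ^ 2 / η) := hm2
      _ ≤ 203 * ((6936 / 10 ^ 6 * (η ^ 2 * X ^ 2)) ^ 2 / η) := by gcongr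
      _ = 203 * (6936 / 10 ^ 6) ^ 2 * (η ^ 3 * X ^ 4) := by field_simp
      _ ≤ _ := by gcongr; norm_num
  have hX1000 : 1000 ≤ X := by
    have : η ^ 2 ≤ 1 := pow_le_one₀ hη.le hη1
    have h3 : η ^ 2 * X ≤ 1 * X := mul_le_mul_of_nonneg_right this hX0.le
    have h4 : l = 1 / 1000 * (η ^ 2 * X) := by rw [hl]; ring
    linarith
  have hX14 : X ^ 14 ≤ η * N / (16 * K) := by
    rw [le_div_iff₀ (by linarith), ← hXN]
    calc X ^ 14 * (16 * K) ≤ X ^ 14 * (16 * (6936 / 10 ^ 6 * (η ^ 2 * X ^ 2))) := by gcongr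
      _ = (16 * 6936 / 10 ^ 6 * η) * (η * X ^ 16) := by ring
      _ ≤ 1 * (η * X ^ 16) := by gcongr; linarith
      _ = _ := one_mul _
  set M := ⌊η * N / (16 * K)⌋₊ with hMdef
  have hM1 : (M:ℝ) ≤ η * N / (16 * K) := Nat.floor_le (by positivity)
  have hM2 : X ^ 14 / 2 ≤ M := by
    have h1 := Nat.lt_floor_add_one (η * N / (16 * K))
    have : 1 ≤ X ^ 14 / 2 := by
      have : (1000:ℝ) ^ 14 ≤ X ^ 14 := by gcongr
      norm_num at this ⊢; linarith
    linarith
  have hMm : 2 ^ 26 * m ^ 7 ≤ M ^ 2 := by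
    have : (2:ℝ) ^ 26 * m ^ 7 ≤ M ^ 2 := by
      calc (2:ℝ) ^ 26 * m ^ 7 ≤ 2 ^ 26 * (1 / 100 * (η ^ 3 * X ^ 4)) ^ 7 := by gcongr
        _ = 2 ^ 26 / 100 ^ 7 * η ^ 21 * X ^ 28 := by ring
        _ ≤ 1 / 4 * 1 * X ^ 28 := by
          have g1 : η ^ 21 ≤ 1 := pow_le_one₀ hη.le hη1
          have g2 : (2:ℝ) ^ 26 / 100 ^ 7 ≤ 1 / 4 := by norm_num
          exact mul_le_mul_of_nonneg_right
            (mul_le_mul g2 g1 (by positivity) (by norm_num)) (by positivity)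
        _ = (X ^ 14 / 2) ^ 2 := by ring
        _ ≤ _ := by gcongr
    exact_mod_cast this
  obtain ⟨q, hq1, hqM, z, hz⟩ := heilbronn α m M (by exact_mod_cast hmone) hMm
  have hqMR : (q:ℝ) ≤ M := by exact_mod_cast hqM
  have hpi := Real.pi_lt_d4
  have hpi0 := Real.pi_pos
  obtain ⟨a, d, hd, had, hs⟩ := core f hf N hf0 α b c η hη h q R K L hq1 hR0 hK0 hL0 _ z hz
    (by
      have : (q:ℝ) ≤ η * N / (16 * K) := hqMR.trans hM1
      rw [le_div_iff₀ (by linarith)] at this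
      linarith)
    (by
      have : 16 * (R * L : ℝ) ≤ K * η := by
        have := mul_le_mul_of_nonneg_right hK1 hη.le
        have e : 16 * (R * L / η) * η = 16 * (R * L : ℝ) := by field_simp
        linarith
      linarith)
    (by
      have t1 : 2 / (m:ℝ) * K ^ 2 ≤ η / 101 := by
        rw [div_mul_eq_mul_div, div_le_iff₀ (by linarith)]
        have := mul_le_mul_of_nonneg_left hm1 hη.le
        have e : η * (202 * ((K:ℝ) ^ 2 / η)) = 202 * (K:ℝ) ^ 2 := by field_simp
        linarith
      have t2 : (L:ℝ) / R ≤ η / 101 := by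
        rw [div_le_iff₀ (by linarith)]
        have := mul_le_mul_of_nonneg_left hR1 hη.le
        have e : η * (101 * (L / η)) = 101 * (L:ℝ) := by field_simp
        linarith
      calc 2 * Real.pi * (2 / (m:ℝ) * K ^ 2 + L / R) ≤ 2 * Real.pi * (η / 101 + η / 101) := by gcongr
        _ ≤ η / 8 := by nlinarith)
  exact ⟨a, d, L, hd, hL0, had, hL1, hs⟩

theorem stmt_19 :
    ∃ c : ℝ, 0 < c ∧ ∀ (N : ℕ) (A : Finset ℕ), 0 < N → A ⊆ Finset.Icc 1 N →
      ∀ (η : ℝ), 0 < η → ∀ α1 α2 : ℝ,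
      η * N ≤ ‖∑ n ∈ Finset.Icc 1 N,
          ((if n ∈ A then (1:ℂ) else 0) - ((A.card : ℝ) / N : ℝ)) *
            Complex.exp (2 * Real.pi * Complex.I * (α2 * (n:ℝ) ^ 2 + α1 * (n:ℝ)))‖ →
      ∃ a d L : ℕ, 0 < d ∧ 0 < L ∧
        (∀ k < L, a + k * d ∈ Finset.Icc 1 N) ∧
        c * η ^ 2 * (N : ℝ) ^ ((1:ℝ)/16) ≤ L ∧
        ((A.card : ℝ) / N + η / 4) * L ≤
          ((A ∩ (Finset.range L).image (fun k => a + k * d)).card : ℝ) := by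
  refine ⟨1 / 1000, by norm_num, ?_⟩
  intro N A hN hA η hη α1 α2 h
  have hNR : (0:ℝ) < N := by exact_mod_cast hN
  set δ : ℝ := (A.card : ℝ) / N with hδ
  have hδ0 : 0 ≤ δ := by positivity
  have hδ1 : δ ≤ 1 := by
    rw [hδ, div_le_one hNR]
    have := Finset.card_le_card hA
    rw [Nat.card_Icc] at this
    exact_mod_cast (by omega : A.card ≤ N)
  let f : ℕ → ℝ := fun i => (if i + 1 ∈ A then (1:ℝ) else 0) - δ
  have hf : ∀ i, |f i| ≤ 1 := by
    intro i; simp only [f]; rw [abs_le]; split_ifs <;> constructor <;> linarith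
  have hIcc : ∀ {E : Type} [AddCommMonoid E] (g : ℕ → E),
      ∑ n ∈ Finset.Icc 1 N, g n = ∑ i ∈ Finset.range N, g (i + 1) := by
    intro E _ g
    rw [Finset.range_eq_Ico, Finset.sum_Ico_add' g 0 N 1]
    rfl
  have hf0 : ∑ i ∈ Finset.range N, f i = 0 := by
    rw [← hIcc (fun n => (if n ∈ A then (1:ℝ) else 0) - δ), Finset.sum_sub_distrib,
      Finset.sum_ite_mem, Finset.inter_eq_right.mpr hA]
    simp [hδ]
    field_simp; ring
  have h' : η * N ≤ ‖∑ i ∈ Finset.range N, (f i : ℂ) *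
      ee (α2 * (i:ℝ) ^ 2 + (2 * α2 + α1) * i + (α2 + α1))‖ := by
    refine h.trans (le_of_eq ?_)
    rw [hIcc]
    congr 1
    apply Finset.sum_congr rfl; intro i _
    congr 1
    · simp only [f]; push_cast; split_ifs <;> simp
    · unfold ee; congr 1; push_cast; ring
  obtain ⟨a, d, L, hd, hL, had, hLb, hs⟩ := params f hf N hN hf0 _ _ _ η hη h'
  refine ⟨a + 1, d, L, hd, hL, ?_, hLb, ?_⟩
  · intro k hk
    rw [Finset.mem_Icc]
    have : k * d ≤ d * (L - 1) := by rw [mul_comm]; gcongr; omega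
    omega
  · have hinj : Function.Injective (fun k => a + 1 + k * d) := by
      intro x y hxy
      simp only at hxy
      exact Nat.eq_of_mul_eq_mul_right hd (by omega)
    have hcard : ((A ∩ (Finset.range L).image (fun k => a + 1 + k * d)).card : ℝ)
        = ∑ k ∈ Finset.range L, (if a + d * k + 1 ∈ A then (1:ℝ) else 0) := by
      rw [Finset.inter_comm, ← Finset.filter_mem_eq_inter, Finset.card_filter,
        Finset.sum_image (fun x _ y _ hxy => hinj hxy)]
      push_cast
      apply Finset.sum_congr rfl; intro k _
      have : a + 1 + k * d = a + d * k + 1 := by ring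
      rw [this]
    rw [hcard]
    simp only [f, Finset.sum_sub_distrib, Finset.sum_const, Finset.card_range, nsmul_eq_mul] at hs
    linarith
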